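/- For every C > 0 and every ε > 0 there exist δ > 0 and N such that for all n ≥ N, all integers k with |k − 2·log₂ n| ≤ C·log log n, and all integers i with 0 ≤ i ≤ δ·(log n)/(log log n): the probability that in G_{n,1/2} there exist two distinct intersecting (k+1)-element vertex subsets S₁ ≠ S₂, each inducing exactly i or exactly i+1 edges, is at most n^{−1+ε}·(E[Z_{k+1,i}]² + E[Z_{k+1,i}]), where E[Z_{k+1,i}] = C(n,k+1)·C(C(k+1,2), i)·2^{−C(k+1,2)}. -/

import Mathlib

open scoped Classical

/-- Probability of an event under the uniform measure on simple graphs on `Fin n`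
(equivalently, `G_{n,1/2}`). -/
noncomputable def grPr (n : ℕ) (S : Set (SimpleGraph (Fin n))) : ℝ :=
  ((PMF.uniformOfFintype (SimpleGraph (Fin n))).toOuterMeasure S).toReal

/-- Number of edges of `G` with both endpoints in `s`. -/
noncomputable def edgesIn {n : ℕ} (G : SimpleGraph (Fin n)) (s : Finset (Fin n)) : ℕ :=
  {e ∈ G.edgeSet | ∀ v ∈ e, v ∈ s}.ncard

/-- `E[Z_{k+1,i}] = C(n,k+1)·C(C(k+1,2),i)·2^{-C(k+1,2)}`. -/
noncomputable def expZ (n k i : ℕ) : ℝ :=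
  (n.choose k : ℝ) * ((k.choose 2).choose i : ℝ) / 2 ^ (k.choose 2)

/-- The edges of the complete graph on `s`. -/
noncomputable def edgesOf {n : ℕ} (s : Finset (Fin n)) : Finset (Sym2 (Fin n)) :=
  s.sym2.filter fun e => ¬ e.IsDiag

lemma card_edgesOf {n : ℕ} (s : Finset (Fin n)) : (edgesOf s).card = s.card.choose 2 := by
  rw [← Sym2.card_image_offDiag]
  congr 1
  ext e
  induction e using Sym2.ind with
  | _ a b =>
    simp only [edgesOf, Finset.mem_filter, Finset.mk_mem_sym2_iff, Sym2.mk_isDiag_iff,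
      Finset.mem_image, Finset.mem_offDiag, Prod.exists, Function.uncurry_apply_pair, Sym2.eq_iff]
    constructor
    · rintro ⟨⟨ha, hb⟩, hab⟩
      exact ⟨a, b, ⟨ha, hb, hab⟩, Or.inl ⟨rfl, rfl⟩⟩
    · rintro ⟨x, y, ⟨hx, hy, hxy⟩, ⟨rfl, rfl⟩ | ⟨rfl, rfl⟩⟩
      · exact ⟨⟨hx, hy⟩, hxy⟩
      · exact ⟨⟨hy, hx⟩, fun h => hxy h.symm⟩

lemma edgesOf_inter {n : ℕ} (s t : Finset (Fin n)) :
    edgesOf s ∩ edgesOf t = edgesOf (s ∩ t) := by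
  ext e
  simp only [edgesOf, Finset.mem_inter, Finset.mem_filter, Finset.mem_sym2_iff]
  grind

lemma card_edgesOf_union {n : ℕ} (s t : Finset (Fin n)) :
    (edgesOf s ∪ edgesOf t).card + (s ∩ t).card.choose 2 =
      s.card.choose 2 + t.card.choose 2 := by
  rw [← card_edgesOf, ← edgesOf_inter, Finset.card_union_add_card_inter, card_edgesOf,
    card_edgesOf]

lemma edgesIn_eq_card {n : ℕ} (G : SimpleGraph (Fin n)) (s : Finset (Fin n)) :
    edgesIn G s = ((edgesOf s).filter (· ∈ G.edgeSet)).card := by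
  rw [edgesIn, ← Set.ncard_coe_finset]
  congr 1
  ext e
  simp only [edgesOf, Finset.coe_filter, Finset.mem_filter, Finset.mem_sym2_iff, Set.mem_ofPred_eq]
  constructor
  · rintro ⟨h1, h2⟩
    exact ⟨⟨h2, G.not_isDiag_of_mem_edgeSet h1⟩, h1⟩
  · rintro ⟨⟨h2, -⟩, h1⟩
    exact ⟨h1, h2⟩

lemma card_graphs_with_pattern_mul_le {n : ℕ} (F A : Finset (Sym2 (Fin n)))
    (hF : ∀ e ∈ F, ¬ e.IsDiag) :
    (Finset.univ.filter fun G : SimpleGraph (Fin n) => ∀ e ∈ F, e ∈ G.edgeSet ↔ e ∈ A).card *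
      2 ^ F.card ≤ Fintype.card (SimpleGraph (Fin n)) := by
  rw [← Finset.card_powerset, ← Finset.card_product, ← Finset.card_univ]
  have key : ∀ (G : SimpleGraph (Fin n)) (T : Finset (Sym2 (Fin n))), T ⊆ F →
      (SimpleGraph.fromEdgeSet ((G.edgeSet \ F) ∪ T)).edgeSet = (G.edgeSet \ F) ∪ T := by
    intro G T hT
    rw [SimpleGraph.edgeSet_fromEdgeSet, sdiff_eq_left, Set.disjoint_left]
    rintro e (he | he)
    · exact G.not_isDiag_of_mem_edgeSet he.1
    · exact hF e (hT he)
  refine Finset.card_le_card_of_injOn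
    (fun p => SimpleGraph.fromEdgeSet ((p.1.edgeSet \ F) ∪ p.2))
    (fun _ _ => Finset.mem_coe.2 (Finset.mem_univ _)) ?_
  rintro ⟨G, T⟩ h ⟨G', T'⟩ h' heq
  simp only [Finset.coe_product, Set.mem_prod, Finset.mem_coe, Finset.mem_filter,
    Finset.mem_univ, true_and, Finset.mem_powerset] at h h'
  have he := congrArg SimpleGraph.edgeSet heq
  simp only [key G T h.2, key G' T' h'.2] at he
  have hmem : ∀ e, (e ∈ G.edgeSet ∧ e ∉ F ∨ e ∈ T) ↔ (e ∈ G'.edgeSet ∧ e ∉ F ∨ e ∈ T') := by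
    intro e
    simpa using Set.ext_iff.1 he e
  rw [Prod.mk.injEq]
  constructor
  · rw [← SimpleGraph.edgeSet_inj]
    ext e
    by_cases heF : e ∈ F
    · rw [h.1 e heF, h'.1 e heF]
    · have h1 : e ∉ T := fun h1 => heF (h.2 h1)
      have h2 : e ∉ T' := fun h1 => heF (h'.2 h1)
      simpa [heF, h1, h2] using hmem e
  · ext e
    by_cases heF : e ∈ F
    · simpa [heF] using hmem e
    · exact ⟨fun h1 => absurd (h.2 h1) heF, fun h1 => absurd (h'.2 h1) heF⟩

/-- The sets of `i` or `i + 1` edges on the vertex set `s`. -/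
noncomputable def edgeChoices {n : ℕ} (i : ℕ) (s : Finset (Fin n)) :
    Finset (Finset (Sym2 (Fin n))) :=
  (edgesOf s).powersetCard i ∪ (edgesOf s).powersetCard (i + 1)

lemma card_edgeChoices_le {n : ℕ} (i : ℕ) (s : Finset (Fin n)) :
    (edgeChoices i s).card ≤ (s.card.choose 2 + 1) ^ (i + 1) := by
  refine (Finset.card_union_le _ _).trans ?_
  rw [Finset.card_powersetCard, Finset.card_powersetCard, card_edgesOf, ← Nat.choose_succ_succ]
  exact Nat.choose_le_pow _ _

lemma card_pair_event_mul_le {n : ℕ} (i : ℕ) (s t : Finset (Fin n)) :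
    (Finset.univ.filter fun G : SimpleGraph (Fin n) =>
      (edgesIn G s = i ∨ edgesIn G s = i + 1) ∧ (edgesIn G t = i ∨ edgesIn G t = i + 1)).card *
      2 ^ (s.card.choose 2 + t.card.choose 2) ≤
    (s.card.choose 2 + 1) ^ (i + 1) * (t.card.choose 2 + 1) ^ (i + 1) *
      2 ^ (s ∩ t).card.choose 2 * Fintype.card (SimpleGraph (Fin n)) := by
  have hsub : (Finset.univ.filter fun G : SimpleGraph (Fin n) =>
      (edgesIn G s = i ∨ edgesIn G s = i + 1) ∧ (edgesIn G t = i ∨ edgesIn G t = i + 1)) ⊆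
      (edgeChoices i s ×ˢ edgeChoices i t).biUnion fun p =>
        Finset.univ.filter fun G : SimpleGraph (Fin n) =>
          ∀ e ∈ edgesOf s ∪ edgesOf t, e ∈ G.edgeSet ↔ e ∈ p.1 ∪ p.2 := by
    intro G hG
    simp only [Finset.mem_filter, Finset.mem_univ, true_and, edgesIn_eq_card] at hG
    simp only [Finset.mem_biUnion, Finset.mem_product, Finset.mem_filter, Finset.mem_univ,
      true_and, edgeChoices, Finset.mem_union, Finset.mem_powersetCard]
    refine ⟨((edgesOf s).filter (· ∈ G.edgeSet), (edgesOf t).filter (· ∈ G.edgeSet)), ?_, ?_⟩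
    · simpa [Finset.filter_subset] using hG
    · intro e he
      simp only [Finset.mem_filter]
      tauto
  have hdiag : ∀ e ∈ edgesOf s ∪ edgesOf t, ¬ e.IsDiag := by
    intro e he
    simp only [edgesOf, Finset.mem_union, Finset.mem_filter] at he
    tauto
  rw [← card_edgesOf_union, pow_add, ← mul_assoc]
  calc _ ≤ (∑ p ∈ edgeChoices i s ×ˢ edgeChoices i t,
        (Finset.univ.filter fun G : SimpleGraph (Fin n) =>
          ∀ e ∈ edgesOf s ∪ edgesOf t, e ∈ G.edgeSet ↔ e ∈ p.1 ∪ p.2).card) *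
        2 ^ (edgesOf s ∪ edgesOf t).card * 2 ^ (s ∩ t).card.choose 2 := by
        gcongr
        exact (Finset.card_le_card hsub).trans Finset.card_biUnion_le
    _ ≤ (∑ p ∈ edgeChoices i s ×ˢ edgeChoices i t, Fintype.card (SimpleGraph (Fin n))) *
        2 ^ (s ∩ t).card.choose 2 := by
        rw [Finset.sum_mul]
        gcongr with p hp
        exact card_graphs_with_pattern_mul_le _ _ hdiag
    _ ≤ _ := by
        rw [Finset.sum_const, Finset.card_product, smul_eq_mul, mul_right_comm]
        gcongr <;> exact card_edgeChoices_le _ _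

lemma card_inter_eq_le {n K l : ℕ} (s : Finset (Fin n)) (hs : s.card = K) :
    (Finset.univ.filter fun t : Finset (Fin n) => t.card = K ∧ (s ∩ t).card = l).card ≤
      K.choose l * n.choose (K - l) := by
  have : (s.powersetCard l ×ˢ (Finset.univ : Finset (Fin n)).powersetCard (K - l)).card =
      K.choose l * n.choose (K - l) := by
    rw [Finset.card_product, Finset.card_powersetCard, Finset.card_powersetCard, hs,
      Finset.card_univ, Fintype.card_fin]
  rw [← this]
  refine Finset.card_le_card_of_injOn (fun t => (s ∩ t, t \ s)) ?_ ?_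
  · intro t ht
    simp only [Finset.coe_filter, Finset.mem_univ, true_and, Set.mem_ofPred_eq] at ht
    have h1 := Finset.card_sdiff_add_card_inter t s
    rw [Finset.inter_comm] at h1
    simp only [Finset.coe_product, Set.mem_prod, Finset.mem_coe, Finset.mem_powersetCard,
      Finset.inter_subset_left, Finset.subset_univ, true_and]
    omega
  · intro t _ t' _ h
    simp only [Prod.mk.injEq] at h
    rw [← Finset.sdiff_union_inter t s, ← Finset.sdiff_union_inter t' s, h.2,
      Finset.inter_comm t, Finset.inter_comm t', h.1]

/-- The expected number of intersecting pairs with overlap `l`, relative to the expected number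
of independent `K`-sets. -/
noncomputable def overlapWeight (n K l : ℕ) : ℝ :=
  (K.choose l * n.choose (K - l) * 2 ^ l.choose 2 : ℝ) / 2 ^ K.choose 2

lemma grPr_le_of_subset {n : ℕ} {S : Set (SimpleGraph (Fin n))}
    {F : Finset (SimpleGraph (Fin n))} (h : S ⊆ F) :
    grPr n S ≤ (F.card : ℝ) / Fintype.card (SimpleGraph (Fin n)) := by
  rw [grPr, PMF.toOuterMeasure_uniformOfFintype_apply, ENNReal.toReal_div, ENNReal.toReal_natCast,
    ENNReal.toReal_natCast]
  gcongr
  rw [← Set.toFinset_card]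
  exact Finset.card_le_card fun G hG => h (Set.mem_toFinset.1 hG)

lemma grPr_overlap_le (n K i : ℕ) :
    grPr n {G | ∃ S₁ S₂ : Finset (Fin n), S₁ ≠ S₂ ∧ (S₁ ∩ S₂).Nonempty ∧
          S₁.card = K ∧ S₂.card = K ∧
          (edgesIn G S₁ = i ∨ edgesIn G S₁ = i + 1) ∧
          (edgesIn G S₂ = i ∨ edgesIn G S₂ = i + 1)} ≤
      ((K.choose 2 + 1 : ℕ) : ℝ) ^ (2 * (i + 1)) * ((n.choose K : ℝ) / 2 ^ K.choose 2) *
        ∑ l ∈ Finset.Ico 1 K, overlapWeight n K l := by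
  set g : ℕ := Fintype.card (SimpleGraph (Fin n)) with hg
  have hgpos : (0 : ℝ) < g := by exact_mod_cast Fintype.card_pos
  set b := K.choose 2 with hb
  set T : Finset (Fin n) → ℕ → Finset (Finset (Fin n)) := fun s l =>
    Finset.univ.filter fun t : Finset (Fin n) => t.card = K ∧ (s ∩ t).card = l with hT
  set ev : Finset (Fin n) → Finset (Fin n) → Finset (SimpleGraph (Fin n)) := fun s t =>
    Finset.univ.filter fun G : SimpleGraph (Fin n) =>
      (edgesIn G s = i ∨ edgesIn G s = i + 1) ∧ (edgesIn G t = i ∨ edgesIn G t = i + 1) with hev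
  have hsub : {G : SimpleGraph (Fin n) | ∃ S₁ S₂ : Finset (Fin n),
      S₁ ≠ S₂ ∧ (S₁ ∩ S₂).Nonempty ∧ S₁.card = K ∧ S₂.card = K ∧
          (edgesIn G S₁ = i ∨ edgesIn G S₁ = i + 1) ∧
          (edgesIn G S₂ = i ∨ edgesIn G S₂ = i + 1)} ⊆
      ↑(((Finset.univ : Finset (Fin n)).powersetCard K).biUnion fun s =>
        (Finset.Ico 1 K).biUnion fun l => (T s l).biUnion fun t => ev s t) := by
    intro G hG
    obtain ⟨s, t, hne, hint, hs, ht, h⟩ := hG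
    simp only [Finset.mem_coe, Finset.mem_biUnion, Finset.mem_powersetCard, Finset.subset_univ,
      true_and, Finset.mem_Ico, hT, hev, Finset.mem_filter, Finset.mem_univ]
    refine ⟨s, hs, (s ∩ t).card, ⟨hint.card_pos, ?_⟩, t, ⟨ht, rfl⟩, h⟩
    rw [← hs]
    refine Finset.card_lt_card (Finset.inter_subset_left.ssubset_of_ne fun h => hne ?_)
    exact Finset.eq_of_subset_of_card_le (Finset.inter_eq_left.1 h) (by omega)
  have hpair : ∀ s ∈ (Finset.univ : Finset (Fin n)).powersetCard K, ∀ l, ∀ t ∈ T s l,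
      ((ev s t).card : ℝ) ≤
        ((b + 1 : ℕ) : ℝ) ^ (2 * (i + 1)) * 2 ^ l.choose 2 * g / (2 ^ b) ^ 2 := by
    intro s hs l t ht
    simp only [Finset.mem_powersetCard, Finset.subset_univ, true_and] at hs
    simp only [hT, Finset.mem_filter, Finset.mem_univ, true_and] at ht
    rw [le_div_iff₀ (by positivity)]
    have := card_pair_event_mul_le i s t
    rw [hs, ht.1, ht.2, ← pow_add, ← hb, ← two_mul, ← two_mul] at this
    rw [← pow_mul, mul_comm b]
    exact_mod_cast this
  refine (grPr_le_of_subset hsub).trans ((div_le_iff₀ hgpos).2 ?_)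
  calc _ ≤ ∑ s ∈ (Finset.univ : Finset (Fin n)).powersetCard K, ∑ l ∈ Finset.Ico 1 K,
        ∑ t ∈ T s l, ((ev s t).card : ℝ) := by
        refine ((Nat.cast_le (α := ℝ)).2 Finset.card_biUnion_le).trans ?_
        push_cast
        gcongr with s hs
        refine ((Nat.cast_le (α := ℝ)).2 Finset.card_biUnion_le).trans ?_
        push_cast
        gcongr with l hl
        refine ((Nat.cast_le (α := ℝ)).2 Finset.card_biUnion_le).trans ?_
        rw [Nat.cast_sum]
    _ ≤ ∑ s ∈ (Finset.univ : Finset (Fin n)).powersetCard K, ∑ l ∈ Finset.Ico 1 K,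
        ((K.choose l * n.choose (K - l) : ℕ) : ℝ) *
        (((b + 1 : ℕ) : ℝ) ^ (2 * (i + 1)) * 2 ^ l.choose 2 * g / (2 ^ b) ^ 2) := by
        gcongr with s hs l hl
        refine (Finset.sum_le_card_nsmul _ _ _ (hpair s hs l)).trans ?_
        rw [nsmul_eq_mul]
        gcongr
        exact card_inter_eq_le s (Finset.mem_powersetCard.1 hs).2
    _ = _ := by
        rw [Finset.sum_const, Finset.card_powersetCard, Finset.card_univ, Fintype.card_fin,
          nsmul_eq_mul, Finset.mul_sum, Finset.mul_sum, Finset.sum_mul]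
        refine Finset.sum_congr rfl fun l _ => ?_
        rw [overlapWeight, ← hb]
        push_cast
        field_simp

lemma choose_sub_mul_pow_le {n K : ℕ} (l : ℕ) (hl : l ≤ K) :
    n.choose (K - l) * (n - K) ^ l ≤ n.choose K * K ^ l := by
  induction l with
  | zero => simp
  | succ l ih =>
    have h1 := Nat.choose_succ_right_eq n (K - (l + 1))
    have h2 : K - (l + 1) + 1 = K - l := by omega
    rw [h2] at h1
    calc n.choose (K - (l + 1)) * (n - K) ^ (l + 1)
        = n.choose (K - (l + 1)) * (n - K) * (n - K) ^ l := by ring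
      _ ≤ n.choose (K - (l + 1)) * (n - (K - (l + 1))) * (n - K) ^ l := by gcongr; omega
      _ = (K - l) * (n.choose (K - l) * (n - K) ^ l) := by rw [← h1]; ring
      _ ≤ K * (n.choose K * K ^ l) := Nat.mul_le_mul (Nat.sub_le _ _) (ih (by omega))
      _ = _ := by ring

lemma overlapWeight_le_of_small {n K t : ℕ} (hK : t + 1 ≤ K) (hn : 2 * K ≤ n)
    (h : 2 * (K : ℝ) ^ 2 * 2 ^ ((t + 1 : ℝ) / 2) ≤ n) :
    overlapWeight n K (t + 1) ≤
      (n.choose K : ℝ) / 2 ^ K.choose 2 * (2 * (K : ℝ) ^ 2 / n) := by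
  have hn0 : (0 : ℝ) < n := by
    have : 0 < n := by omega
    exact_mod_cast this
  have hc : (n.choose (K - (t + 1)) : ℝ) * (n / 2) ^ (t + 1) ≤ n.choose K * K ^ (t + 1) := by
    have h1 := choose_sub_mul_pow_le (n := n) (t + 1) hK
    have h2 : (n : ℝ) / 2 ≤ ((n - K : ℕ) : ℝ) := by
      rw [Nat.cast_sub (by omega)]
      have : (2 * K : ℝ) ≤ n := by exact_mod_cast hn
      linarith
    calc _ ≤ (n.choose (K - (t + 1)) : ℝ) * ((n - K : ℕ) : ℝ) ^ (t + 1) := by gcongr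
      _ ≤ _ := by exact_mod_cast h1
  have hp : (2 : ℝ) ^ (t + 1).choose 2 = (2 ^ ((t + 1 : ℝ) / 2)) ^ t := by
    rw [← Real.rpow_natCast, ← Real.rpow_natCast, ← Real.rpow_mul (by norm_num),
      Nat.cast_choose_two]
    congr 1
    push_cast
    ring
  have hk : (K.choose (t + 1) : ℝ) ≤ K ^ (t + 1) := by exact_mod_cast Nat.choose_le_pow _ _
  set w : ℝ := 2 ^ ((t + 1 : ℝ) / 2) with hw
  have hw0 : 0 < w := by positivity
  have hpow : (2 * (K : ℝ) ^ 2 * w) ^ t ≤ n ^ t := by gcongr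
  rw [overlapWeight, hp, div_mul_eq_mul_div]
  refine div_le_div_of_nonneg_right ?_ (by positivity)
  have hc' : (n.choose (K - (t + 1)) : ℝ) ≤ n.choose K * K ^ (t + 1) * (2 / n) ^ (t + 1) := by
    have : (n.choose (K - (t + 1)) : ℝ) =
        n.choose (K - (t + 1)) * (n / 2) ^ (t + 1) * (2 / n) ^ (t + 1) := by
      rw [mul_assoc, ← mul_pow]
      field_simp
      simp
    rw [this]
    gcongr
  calc _ ≤ (K : ℝ) ^ (t + 1) * (n.choose K * K ^ (t + 1) * (2 / n) ^ (t + 1)) * w ^ t :=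
      mul_le_mul_of_nonneg_right (mul_le_mul hk hc' (by positivity) (by positivity)) (by positivity)
    _ = n.choose K * (2 * (K : ℝ) ^ 2 / n) * ((2 * (K : ℝ) ^ 2 * w) ^ t / n ^ t) := by
      simp only [mul_pow, div_pow, pow_succ]
      field_simp
      ring
    _ ≤ n.choose K * (2 * (K : ℝ) ^ 2 / n) * 1 := by
      gcongr
      exact div_le_one_of_le₀ hpow (by positivity)
    _ = _ := mul_one _

lemma overlapWeight_le_of_large {n K l t : ℕ} (hK : l + (t + 1) = K)
    (h : (K : ℝ) * n * 2 ^ ((t + 3 : ℝ) / 2) ≤ 2 ^ K) :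
    overlapWeight n K l ≤ 2 * (K : ℝ) * n / 2 ^ K := by
  have hc : (n.choose (K - l) : ℝ) ≤ n ^ (t + 1) := by
    rw [show K - l = t + 1 by omega]
    exact_mod_cast Nat.choose_le_pow _ _
  have hk : (K.choose l : ℝ) ≤ K ^ (t + 1) := by
    rw [← Nat.choose_symm (show l ≤ K by omega), show K - l = t + 1 by omega]
    exact_mod_cast Nat.choose_le_pow _ _
  set w : ℝ := 2 ^ ((t + 3 : ℝ) / 2) with hw
  have hp : (2 : ℝ) ^ l.choose 2 * (2 ^ K) ^ (t + 1) = 2 * w ^ t * 2 ^ K.choose 2 := by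
    rw [hw, ← Real.rpow_natCast, ← Real.rpow_natCast, ← Real.rpow_natCast, ← Real.rpow_natCast,
      ← Real.rpow_natCast, ← Real.rpow_mul (by norm_num), ← Real.rpow_mul (by norm_num),
      ← Real.rpow_add (by norm_num), ← Real.rpow_one_add' (by norm_num) (by positivity),
      ← Real.rpow_add (by norm_num), Nat.cast_choose_two, Nat.cast_choose_two, ← hK]
    congr 1
    push_cast
    ring
  have hpow : ((K : ℝ) * n * w) ^ t ≤ (2 ^ K) ^ t := by
    have : 0 < w := by positivity
    gcongr
  have hp' : (2 : ℝ) ^ l.choose 2 / 2 ^ K.choose 2 = 2 * w ^ t / (2 ^ K) ^ (t + 1) := by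
    rw [div_eq_div_iff (by positivity) (by positivity), hp]
  rw [overlapWeight, mul_div_assoc, hp']
  have hw0 : 0 < w := by positivity
  calc _ ≤ (K : ℝ) ^ (t + 1) * n ^ (t + 1) * (2 * w ^ t / (2 ^ K) ^ (t + 1)) := by gcongr
    _ = 2 * (K : ℝ) * n / 2 ^ K * (((K : ℝ) * n * w) ^ t / (2 ^ K) ^ t) := by
      simp only [mul_pow, pow_succ]
      field_simp
    _ ≤ 2 * (K : ℝ) * n / 2 ^ K * 1 := by
      gcongr
      exact div_le_one_of_le₀ hpow (by positivity)
    _ = _ := mul_one _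

lemma overlapWeight_le {n K l : ℕ} {x D : ℝ} (hn : (n : ℝ) = Real.exp x) (hx : 16 ≤ x)
    (hl : 1 ≤ l) (hlK : l < K) (hK : (K : ℝ) ≤ 2 * (x / Real.log 2) + x / 10) (hD : 1 ≤ D)
    (h2K : Real.exp (2 * x) ≤ 2 ^ K * D) (hM : 8 * (K : ℝ) ^ 2 * D ≤ Real.exp (x / 4)) :
    overlapWeight n K l ≤
      (1 + (n.choose K : ℝ) / 2 ^ K.choose 2) * (8 * (K : ℝ) ^ 2 * D / n) := by
  have hlog0 : 0 < Real.log 2 := Real.log_pos (by norm_num)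
  have hlog1 : Real.log 2 < 0.7 := by linarith [Real.log_two_lt_d9]
  have hn0 : (0 : ℝ) < n := hn ▸ Real.exp_pos x
  have hK1 : (1 : ℝ) ≤ K := by exact_mod_cast (by omega : 1 ≤ K)
  have hKK : (K : ℝ) ≤ K ^ 2 := by nlinarith
  have hK2D : (K : ℝ) ^ 2 ≤ K ^ 2 * D := le_mul_of_one_le_right (by positivity) hD
  have hKD : (K : ℝ) * D ≤ K ^ 2 * D := by gcongr
  have hq : Real.exp (x / 4) ≤ n := by
    rw [hn]; exact Real.exp_le_exp.2 (by linarith)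
  rw [add_mul, one_mul]
  by_cases hsplit : (l : ℝ) ≤ 3 / 2 * (x / Real.log 2)
  · obtain ⟨t, rfl⟩ : ∃ t, l = t + 1 := ⟨l - 1, by omega⟩
    push_cast at hsplit
    have hpow : (2 : ℝ) ^ ((t + 1 : ℝ) / 2) ≤ Real.exp (3 / 4 * x) := by
      rw [Real.rpow_def_of_pos (by norm_num)]
      refine Real.exp_le_exp.2 ?_
      have := mul_le_mul_of_nonneg_left hsplit hlog0.le
      rw [show Real.log 2 * (3 / 2 * (x / Real.log 2)) = 3 / 2 * x by field_simp] at this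
      linarith
    have h1 : 2 * (K : ℝ) ^ 2 * 2 ^ ((t + 1 : ℝ) / 2) ≤ n := by
      calc _ ≤ Real.exp (x / 4) * Real.exp (3 / 4 * x) := by gcongr; linarith
        _ = n := by rw [hn, ← Real.exp_add]; ring_nf
    have h2 : 2 * K ≤ n := by
      have : (2 * K : ℝ) ≤ n := by linarith
      exact_mod_cast this
    calc _ ≤ (n.choose K : ℝ) / 2 ^ K.choose 2 * (2 * (K : ℝ) ^ 2 / n) :=
          overlapWeight_le_of_small hlK.le h2 h1
      _ ≤ (n.choose K : ℝ) / 2 ^ K.choose 2 * (8 * (K : ℝ) ^ 2 * D / n) := by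
          gcongr ?_ * (?_ / _)
          linarith
      _ ≤ _ := le_add_of_nonneg_left (by positivity)
  · push Not at hsplit
    obtain ⟨t, ht⟩ : ∃ t, l + (t + 1) = K := ⟨K - l - 1, by omega⟩
    have ht' : (l : ℝ) + (t + 1) = K := by exact_mod_cast ht
    have hpow : (2 : ℝ) ^ ((t + 3 : ℝ) / 2) ≤ Real.exp (x / 2) := by
      rw [Real.rpow_def_of_pos (by norm_num)]
      refine Real.exp_le_exp.2 ?_
      have h1 : (t + 3 : ℝ) / 2 ≤ 1 / 4 * (x / Real.log 2) + (x / 20 + 1) := by linarith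
      have := mul_le_mul_of_nonneg_left h1 hlog0.le
      rw [mul_add, show Real.log 2 * (1 / 4 * (x / Real.log 2)) = 1 / 4 * x by field_simp] at this
      nlinarith
    have h1 : (K : ℝ) * n * 2 ^ ((t + 3 : ℝ) / 2) ≤ 2 ^ K := by
      have h2 : (K : ℝ) * n * 2 ^ ((t + 3 : ℝ) / 2) * D ≤ 2 ^ K * D := by
        calc _ = (K : ℝ) * D * n * 2 ^ ((t + 3 : ℝ) / 2) := by ring
          _ ≤ Real.exp (x / 4) * Real.exp x * Real.exp (x / 2) := by
            rw [← hn]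
            gcongr
            nlinarith
          _ ≤ Real.exp (2 * x) := by
            rw [← Real.exp_add, ← Real.exp_add]
            exact Real.exp_le_exp.2 (by linarith)
          _ ≤ _ := h2K
      exact le_of_mul_le_mul_right h2 (by linarith)
    calc _ ≤ 2 * (K : ℝ) * n / 2 ^ K := overlapWeight_le_of_large ht h1
      _ ≤ 8 * (K : ℝ) ^ 2 * D / n := by
        rw [div_le_div_iff₀ (by positivity) hn0]
        have h3 : (n : ℝ) * n ≤ 2 ^ K * D := by
          rw [hn, ← Real.exp_add, ← two_mul]; exact h2K
        calc 2 * (K : ℝ) * n * n = 2 * K * (n * n) := by ring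
          _ ≤ 2 * K * (2 ^ K * D) := by gcongr
          _ = 2 * (K * D) * 2 ^ K := by ring
          _ ≤ 8 * (K : ℝ) ^ 2 * D * 2 ^ K := by
            gcongr ?_ * _
            nlinarith
      _ ≤ _ := le_add_of_nonneg_right (by positivity)

lemma choose_two_add_one_le_sq {K : ℕ} (hK : 1 ≤ K) : K.choose 2 + 1 ≤ K ^ 2 := by
  obtain ⟨k, rfl⟩ : ∃ k, K = k + 1 := ⟨K - 1, by omega⟩
  have h := Nat.choose_succ_right_eq (k + 1) 1
  rw [Nat.choose_one_right, Nat.add_sub_cancel] at h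
  nlinarith

lemma eventually_mul_log_add_le (a d : ℝ) {c : ℝ} (hc : 0 < c) :
    ∀ᶠ x : ℝ in Filter.atTop, a * Real.log x + d ≤ c * x := by
  have h1 := (Real.isLittleO_log_id_atTop.const_mul_left a).bound (half_pos hc)
  filter_upwards [h1, Filter.eventually_ge_atTop 0, Filter.eventually_ge_atTop (2 * d / c)]
    with x hx hx0 hxd
  rw [Real.norm_eq_abs, id, Real.norm_of_nonneg hx0] at hx
  rw [div_le_iff₀ hc] at hxd
  linarith [le_abs_self (a * Real.log x)]

theorem stmt9 (C ε : ℝ) (hC : 0 < C) (hε : 0 < ε) :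
    ∃ δ : ℝ, 0 < δ ∧ ∃ N : ℕ, ∀ n : ℕ, N ≤ n → ∀ k i : ℕ,
      |(k : ℝ) - 2 * Real.logb 2 n| ≤ C * Real.log (Real.log n) →
      (i : ℝ) ≤ δ * Real.log n / Real.log (Real.log n) →
      grPr n {G | ∃ S₁ S₂ : Finset (Fin n), S₁ ≠ S₂ ∧ (S₁ ∩ S₂).Nonempty ∧
          S₁.card = k + 1 ∧ S₂.card = k + 1 ∧
          (edgesIn G S₁ = i ∨ edgesIn G S₁ = i + 1) ∧
          (edgesIn G S₂ = i ∨ edgesIn G S₂ = i + 1)} ≤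
        (n : ℝ) ^ (-1 + ε) * (expZ n (k + 1) i ^ 2 + expZ n (k + 1) i) := by
  have hlog0 : 0 < Real.log 2 := Real.log_pos (by norm_num)
  have hlog1 : Real.log 2 < 0.7 := by linarith [Real.log_two_lt_d9]
  have hlog2 : 0.69 < Real.log 2 := by linarith [Real.log_two_gt_d9]
  set η : ℝ := min (1 / 4) (ε / 2) with hη
  have hη0 : 0 < η := by positivity
  have hev : ∀ᶠ x : ℝ in Filter.atTop, 16 ≤ x ∧ 1 ≤ Real.log x ∧
      C * Real.log x + 1 ≤ 1 / 10 * x ∧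
      (6 + C * Real.log 2) * Real.log x + Real.log 8 ≤ η * x ∧
      8 * Real.log x + 0 ≤ ε / 4 * x := by
    filter_upwards [Filter.eventually_ge_atTop 16,
      Real.tendsto_log_atTop.eventually_ge_atTop 1,
      eventually_mul_log_add_le C 1 (by norm_num : (0 : ℝ) < 1 / 10),
      eventually_mul_log_add_le (6 + C * Real.log 2) (Real.log 8) hη0,
      eventually_mul_log_add_le 8 0 (by positivity : 0 < ε / 4)] with x h1 h2 h3 h4 h5
    exact ⟨h1, h2, h3, h4, h5⟩
  obtain ⟨N, hN⟩ := Filter.eventually_atTop.1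
    ((Real.tendsto_log_atTop.comp tendsto_natCast_atTop_atTop).eventually hev)
  refine ⟨min (ε / 32) 1, by positivity, max N 1, fun n hnN k i hk hi => ?_⟩
  obtain ⟨hx, hl1, hC1, hM, hε1⟩ := hN n (le_of_max_le_left hnN)
  simp only [Function.comp_apply] at hx hl1 hC1 hM hε1
  have hn0 : (0 : ℝ) < n := by exact_mod_cast (le_of_max_le_right hnN : 1 ≤ n)
  have hn : (n : ℝ) = Real.exp (Real.log n) := (Real.exp_log hn0).symm
  set x : ℝ := Real.log n with hxdef
  set y : ℝ := Real.log x with hy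
  have hx0 : 0 < x := by linarith
  have hxy : Real.exp y = x := Real.exp_log hx0
  rw [Real.logb, ← hxdef, abs_le] at hk
  have hx2 : x / Real.log 2 ≤ 1.45 * x := by
    rw [div_le_iff₀ hlog0]
    linarith [mul_le_mul_of_nonneg_left hlog2.le hx0.le]
  have hx2' : x ≤ x / Real.log 2 := by
    rw [le_div_iff₀ hlog0]
    linarith [mul_le_mul_of_nonneg_left hlog1.le hx0.le]
  obtain ⟨K, hKdef⟩ : ∃ K : ℕ, K = k + 1 := ⟨_, rfl⟩
  rw [← hKdef]
  have hKk : (K : ℝ) = k + 1 := by rw [hKdef]; push_cast; ring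
  have hK1 : (1 : ℝ) ≤ K := by rw [hKk]; linarith [(Nat.cast_nonneg k : (0 : ℝ) ≤ k)]
  have hKup : (K : ℝ) ≤ 2 * (x / Real.log 2) + x / 10 := by linarith
  have hKexp : (K : ℝ) ≤ Real.exp (2 * y) := by
    rw [two_mul, Real.exp_add, hxy]
    linarith [mul_le_mul_of_nonneg_right hx hx0.le]
  set D : ℝ := Real.exp (C * Real.log 2 * y) with hDdef
  have hD : 1 ≤ D := Real.one_le_exp (by positivity)
  have h2K : Real.exp (2 * x) ≤ 2 ^ K * D := by
    rw [← Real.rpow_natCast, Real.rpow_def_of_pos (by norm_num), ← Real.exp_add]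
    refine Real.exp_le_exp.2 ?_
    have h1 : 2 * (x / Real.log 2) - C * y ≤ K := by linarith
    have := mul_le_mul_of_nonneg_left h1 hlog0.le
    rw [mul_sub, show Real.log 2 * (2 * (x / Real.log 2)) = 2 * x by field_simp] at this
    linarith
  have hM3 : 8 * (K : ℝ) ^ 3 * D ≤ Real.exp (η * x) := by
    calc _ ≤ Real.exp (Real.log 8) * Real.exp (2 * y) ^ 3 * D := by
          rw [Real.exp_log (by norm_num)]
          gcongr
      _ = Real.exp ((6 + C * Real.log 2) * y + Real.log 8) := by
          rw [← Real.exp_nat_mul, hDdef, ← Real.exp_add, ← Real.exp_add]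
          congr 1
          push_cast
          ring
      _ ≤ _ := Real.exp_le_exp.2 hM
  have hM4 : 8 * (K : ℝ) ^ 3 * D ≤ Real.exp (x / 4) :=
    hM3.trans (Real.exp_le_exp.2 (by
      linarith [mul_le_mul_of_nonneg_right (min_le_left (1 / 4) (ε / 2)) hx0.le]))
  have hMε : 8 * (K : ℝ) ^ 3 * D ≤ Real.exp (ε / 2 * x) :=
    hM3.trans (Real.exp_le_exp.2 (by
      linarith [mul_le_mul_of_nonneg_right (min_le_right (1 / 4) (ε / 2)) hx0.le]))
  have hM2 : 8 * (K : ℝ) ^ 2 * D ≤ Real.exp (x / 4) := by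
    refine le_trans ?_ hM4
    have : (K : ℝ) ^ 2 ≤ K ^ 3 := pow_le_pow_right₀ hK1 (by norm_num)
    gcongr
  have hδ : (i : ℝ) * y ≤ min (ε / 32) 1 * x := by
    rwa [le_div_iff₀ (by linarith)] at hi
  have hib : i ≤ K.choose 2 := by
    have h1 : (i : ℝ) ≤ x := by
      have h2 := mul_le_mul_of_nonneg_right (min_le_right (ε / 32) 1) hx0.le
      have h3 := le_mul_of_one_le_right (Nat.cast_nonneg i : (0 : ℝ) ≤ i) hl1
      linarith
    have h2 : (i : ℝ) ≤ k := by linarith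
    have h3 : i ≤ k := by exact_mod_cast h2
    refine h3.trans ?_
    rw [hKdef, Nat.choose_succ_succ' k 1, Nat.choose_one_right]
    exact Nat.le_add_right _ _
  have hb : ((K.choose 2 + 1 : ℕ) : ℝ) ≤ Real.exp (4 * y) := by
    calc ((K.choose 2 + 1 : ℕ) : ℝ) ≤ (K : ℝ) ^ 2 := by
          exact_mod_cast choose_two_add_one_le_sq (by omega)
      _ ≤ Real.exp (2 * y) ^ 2 := by gcongr
      _ = _ := by rw [← Real.exp_nat_mul]; push_cast; ring_nf
  have hB : ((K.choose 2 + 1 : ℕ) : ℝ) ^ (2 * (i + 1)) ≤ Real.exp (ε / 2 * x) := by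
    calc _ ≤ Real.exp (4 * y) ^ (2 * (i + 1)) := by gcongr
      _ = Real.exp (8 * (i * y) + 8 * y) := by
          rw [← Real.exp_nat_mul]; push_cast; ring_nf
      _ ≤ _ := Real.exp_le_exp.2 (by
          linarith [mul_le_mul_of_nonneg_right (min_le_left (ε / 32) 1) hx0.le])
  set ν : ℝ := (n.choose K : ℝ) / 2 ^ K.choose 2 with hν
  have hν0 : 0 ≤ ν := by positivity
  have hνμ : ν ≤ expZ n K i := by
    rw [expZ, hν]
    gcongr
    refine le_mul_of_one_le_right (by positivity) ?_
    exact_mod_cast Nat.choose_pos hib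
  have hsum : ∑ l ∈ Finset.Ico 1 K, overlapWeight n K l ≤
      (1 + ν) * (8 * (K : ℝ) ^ 3 * D / n) := by
    calc _ ≤ ((Finset.Ico 1 K).card : ℝ) * ((1 + ν) * (8 * (K : ℝ) ^ 2 * D / n)) := by
          rw [← nsmul_eq_mul]
          refine Finset.sum_le_card_nsmul _ _ _ fun l hl => ?_
          rw [Finset.mem_Ico] at hl
          exact overlapWeight_le hn hx hl.1 hl.2 hKup hD h2K hM2
      _ ≤ (K : ℝ) * ((1 + ν) * (8 * (K : ℝ) ^ 2 * D / n)) := by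
          gcongr
          simp
      _ = _ := by ring
  calc _ ≤ ((K.choose 2 + 1 : ℕ) : ℝ) ^ (2 * (i + 1)) * ν *
        ∑ l ∈ Finset.Ico 1 K, overlapWeight n K l := grPr_overlap_le n K i
    _ ≤ Real.exp (ε / 2 * x) * ν * ((1 + ν) * (Real.exp (ε / 2 * x) / n)) := by
        refine mul_le_mul (mul_le_mul_of_nonneg_right hB hν0) (hsum.trans (by gcongr)) ?_
          (by positivity)
        exact Finset.sum_nonneg fun l _ => by rw [overlapWeight]; positivity
    _ = (n : ℝ) ^ (-1 + ε) * (ν ^ 2 + ν) := by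
        have : (n : ℝ) ^ (-1 + ε) = Real.exp (ε / 2 * x) * (Real.exp (ε / 2 * x) / n) := by
          rw [Real.rpow_def_of_pos hn0, ← hxdef, hn, ← Real.exp_sub, ← Real.exp_add]
          ring_nf
        rw [this]
        ring
    _ ≤ _ := by gcongr
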